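/- Assume D satisfies condition (H1). Let T > 0, p ≥ 1, let η : [0,T] → ℝ^d be continuous with η_0 = 0, let x : [0,T] → ℝⁿ be a continuous path of finite p-variation with x_0 = 0, let F : ℝ^d ⊗ ℝⁿ → ℝ^d be linear, and let y₀ ∈ cl(D). Then there exists a pair (y, Φ), with y : [0,T] → cl(D) continuous and Φ : [0,T] → ℝ^d continuous of bounded variation with Φ(0) = 0, such that y_t = y₀ + η_t + F(∫_0^t Φ(r) ⊗ dx_r) + Φ(t) for all 0 ≤ t ≤ T, where (y, Φ) is the solution of the Skorohod problem associated with the continuous path t ↦ y₀ + η_t + F(∫_0^t Φ(r) ⊗ dx_r). -/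

import Mathlib

open MeasureTheory Set
open scoped RealInnerProductSpace

noncomputable section

/-- The set of inward unit normal vectors at `x` at radius `r`. -/
def normalVecsAt {d : ℕ} (D : Set (EuclideanSpace ℝ (Fin d)))
    (x : EuclideanSpace ℝ (Fin d)) (r : ℝ) : Set (EuclideanSpace ℝ (Fin d)) :=
  {v | ‖v‖ = 1 ∧ Metric.ball (x - r • v) r ∩ D = ∅}

/-- The set of inward unit normal vectors at `x`. -/
def normalCone {d : ℕ} (D : Set (EuclideanSpace ℝ (Fin d)))
    (x : EuclideanSpace ℝ (Fin d)) : Set (EuclideanSpace ℝ (Fin d)) :=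
  ⋃ r ∈ Set.Ioi (0 : ℝ), normalVecsAt D x r

/-- Condition (A). -/
def CondA {d : ℕ} (D : Set (EuclideanSpace ℝ (Fin d))) (r₀ : ℝ) : Prop :=
  0 < r₀ ∧ ∀ x ∈ frontier D,
    normalCone D x = normalVecsAt D x r₀ ∧ (normalCone D x).Nonempty

/-- Condition (B). -/
def CondB {d : ℕ} (D : Set (EuclideanSpace ℝ (Fin d))) (δ β : ℝ) : Prop :=
  0 < δ ∧ 1 ≤ β ∧ ∀ x ∈ frontier D, ∃ l : EuclideanSpace ℝ (Fin d), ‖l‖ = 1 ∧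
    ∀ y ∈ Metric.ball x δ ∩ frontier D, ∀ v ∈ normalCone D y, 1 / β ≤ ⟪l, v⟫

/-- `‖w‖_{∞,[s,t]}`, the supremum of increments of `w` over `[s,t]`. -/
def supNorm {E : Type*} [NormedAddCommGroup E] (w : ℝ → E) (s t : ℝ) : ℝ :=
  sSup ((fun q : ℝ × ℝ => ‖w q.2 - w q.1‖) '' {q | s ≤ q.1 ∧ q.1 ≤ q.2 ∧ q.2 ≤ t})

/-- `‖φ‖_{[s,t]}`, the total variation of `φ` on `[s,t]`. -/
def totalVar {E : Type*} [NormedAddCommGroup E] (φ : ℝ → E) (s t : ℝ) : ℝ :=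
  (eVariationOn φ (Set.Icc s t)).toReal

/-- A control function on `[0,T]`. -/
structure IsControl (T : ℝ) (ω : ℝ → ℝ → ℝ) : Prop where
  cont : ContinuousOn (fun q : ℝ × ℝ => ω q.1 q.2) {q | 0 ≤ q.1 ∧ q.1 ≤ q.2 ∧ q.2 ≤ T}
  diag : ∀ t, 0 ≤ t → t ≤ T → ω t t = 0
  superadd : ∀ s t u, 0 ≤ s → s ≤ t → t ≤ u → u ≤ T → ω s t + ω t u ≤ ω s u

/-- `(ξ, φ)` is a solution of the Skorohod problem associated with `w` on `[a,b]`. -/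
structure SkorohodSol {d : ℕ} (D : Set (EuclideanSpace ℝ (Fin d))) (a b : ℝ)
    (w ξ φ : ℝ → EuclideanSpace ℝ (Fin d)) : Prop where
  xi_cont : ContinuousOn ξ (Set.Icc a b)
  xi_mem : ∀ t ∈ Set.Icc a b, ξ t ∈ closure D
  phi_cont : ContinuousOn φ (Set.Icc a b)
  phi_bv : BoundedVariationOn φ (Set.Icc a b)
  phi_start : φ a = 0
  eqn : ∀ t ∈ Set.Icc a b, ξ t = w t + φ t
  localTime : ∃ (nv : ℝ → EuclideanSpace ℝ (Fin d)) (μ : Measure ℝ),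
    Measurable nv ∧
    (∀ s ∈ Set.Icc a b, ξ s ∈ frontier D → nv s ∈ normalCone D (ξ s)) ∧
    (∀ u v, a ≤ u → u ≤ v → v ≤ b → μ (Set.Ioc u v) = ENNReal.ofReal (totalVar φ u v)) ∧
    (∀ t ∈ Set.Icc a b,
      φ t = ∫ s in Set.Icc a t, (frontier D).indicator (fun _ => (1 : ℝ)) (ξ s) • nv s ∂μ)

/-- Condition (H1) with constant `C_D`: (A) holds, the Skorohod problem is uniquely
solvable on every subinterval of `[0,T]`, and `‖L(w)‖_{[s,t]} ≤ C_D ‖w‖_{∞,[s,t]}`. -/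
def CondH1 {d : ℕ} (D : Set (EuclideanSpace ℝ (Fin d))) (T C_D : ℝ) : Prop :=
  (∃ r₀, CondA D r₀) ∧ 0 < C_D ∧
  ∀ a b, 0 ≤ a → a ≤ b → b ≤ T →
    ∀ w : ℝ → EuclideanSpace ℝ (Fin d), ContinuousOn w (Set.Icc a b) →
      w a ∈ closure D →
      (∃ ξ φ, SkorohodSol D a b w ξ φ) ∧
      (∀ ξ φ ξ' φ', SkorohodSol D a b w ξ φ → SkorohodSol D a b w ξ' φ' →
        ∀ u ∈ Set.Icc a b, ξ u = ξ' u ∧ φ u = φ' u) ∧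
      (∀ ξ φ, SkorohodSol D a b w ξ φ →
        ∀ s u, a ≤ s → s ≤ u → u ≤ b → totalVar φ s u ≤ C_D * supNorm w s u)

/-- The elementary tensor `a ⊗ b ∈ ℝ^d ⊗ ℝ^n`, realized in `EuclideanSpace ℝ (Fin d × Fin n)`. -/
def outerTensor {d n : ℕ} (a : EuclideanSpace ℝ (Fin d)) (b : EuclideanSpace ℝ (Fin n)) :
    EuclideanSpace ℝ (Fin d × Fin n) :=
  (WithLp.equiv 2 (Fin d × Fin n → ℝ)).symm (fun q => a q.1 * b q.2)

/-- `I` is the (Riemann–Stieltjes/Young) integral `∫_a^b Φ(r) ⊗ dx_r`, the limit of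
left-endpoint Riemann–Stieltjes sums over partitions of `[a,b]` as mesh tends to `0`. -/
def IsRSTensorIntegral {d n : ℕ} (Φ : ℝ → EuclideanSpace ℝ (Fin d))
    (x : ℝ → EuclideanSpace ℝ (Fin n)) (a b : ℝ)
    (I : EuclideanSpace ℝ (Fin d × Fin n)) : Prop :=
  ∀ ε > (0 : ℝ), ∃ η > (0 : ℝ), ∀ (N : ℕ) (t : Fin (N + 1) → ℝ),
    Monotone t → t 0 = a → t (Fin.last N) = b →
    (∀ k : Fin N, t k.succ - t k.castSucc ≤ η) →
    ‖(∑ k : Fin N, outerTensor (Φ (t k.castSucc)) (x (t k.succ) - x (t k.castSucc))) - I‖ ≤ ε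

/-- `x` has finite `p`-variation on `[a,b]`. -/
def FinitePVar {E : Type*} [NormedAddCommGroup E] (x : ℝ → E) (p a b : ℝ) : Prop :=
  ∃ M : ℝ, ∀ (N : ℕ) (t : Fin (N + 1) → ℝ), Monotone t →
    (∀ k : Fin (N + 1), t k ∈ Set.Icc a b) →
    ∑ k : Fin N, ‖x (t k.succ) - x (t k.castSucc)‖ ^ p ≤ M


section Aux

variable {d n : ℕ}

theorem outerTensor_apply (a : EuclideanSpace ℝ (Fin d)) (b : EuclideanSpace ℝ (Fin n))
    (q : Fin d × Fin n) : outerTensor a b q = a q.1 * b q.2 := rfl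

theorem norm_outerTensor (a : EuclideanSpace ℝ (Fin d)) (b : EuclideanSpace ℝ (Fin n)) :
    ‖outerTensor a b‖ = ‖a‖ * ‖b‖ := by
  rw [EuclideanSpace.norm_eq, EuclideanSpace.norm_eq, EuclideanSpace.norm_eq,
    ← Real.sqrt_mul (by positivity)]
  congr 1
  rw [Fintype.sum_prod_type, Finset.sum_mul_sum]
  simp [outerTensor_apply, mul_pow]

/-- The tensor product as a continuous bilinear map. -/
def tensorB (d n : ℕ) : EuclideanSpace ℝ (Fin d) →L[ℝ] EuclideanSpace ℝ (Fin n) →L[ℝ]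
    EuclideanSpace ℝ (Fin d × Fin n) :=
  LinearMap.mkContinuous₂
    (LinearMap.mk₂ ℝ (fun a b => outerTensor a b)
      (by intro a a' b; ext q; simp [outerTensor_apply, add_mul])
      (by intro c a b; ext q; simp [outerTensor_apply, mul_assoc])
      (by intro a b b'; ext q; simp [outerTensor_apply, mul_add])
      (by intro c a b; ext q; simp [outerTensor_apply, mul_left_comm]))
    1 (by intro a b; simp [norm_outerTensor])

theorem tensorB_apply (a : EuclideanSpace ℝ (Fin d)) (b : EuclideanSpace ℝ (Fin n)) :
    tensorB d n a b = outerTensor a b := rfl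

theorem norm_tensorB (a : EuclideanSpace ℝ (Fin d)) (b : EuclideanSpace ℝ (Fin n)) :
    ‖tensorB d n a b‖ = ‖a‖ * ‖b‖ := norm_outerTensor a b

theorem unif_mod {E : Type*} [NormedAddCommGroup E] {f : ℝ → E} {T : ℝ}
    (hf : ContinuousOn f (Icc 0 T)) {ε : ℝ} (hε : 0 < ε) :
    ∃ δ > 0, ∀ u ∈ Icc (0:ℝ) T, ∀ v ∈ Icc (0:ℝ) T, |u - v| ≤ δ → ‖f u - f v‖ ≤ ε := by
  have h := isCompact_Icc.uniformContinuousOn_of_continuous hf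
  rw [Metric.uniformContinuousOn_iff_le] at h
  obtain ⟨δ, hδ, h⟩ := h ε hε
  refine ⟨δ, hδ, fun u hu v hv huv => ?_⟩
  rw [← dist_eq_norm]
  exact h u hu v hv (by rw [Real.dist_eq]; exact huv)

theorem bdd_of_cont {E : Type*} [NormedAddCommGroup E] {f : ℝ → E} {T : ℝ}
    (hf : ContinuousOn f (Icc 0 T)) : ∃ K > 0, ∀ u ∈ Icc (0:ℝ) T, ‖f u‖ ≤ K := by
  obtain ⟨K, hK⟩ := isCompact_Icc.exists_bound_of_continuousOn hf
  exact ⟨max K 1, by positivity, fun u hu => (hK u hu).trans (le_max_left _ _)⟩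

/-- Analytic data extracted from a Skorohod solution. -/
structure SkData (D : Set (EuclideanSpace ℝ (Fin d))) (T : ℝ)
    (ξ φ g : ℝ → EuclideanSpace ℝ (Fin d)) (ν : Measure ℝ) : Prop where
  fin : IsFiniteMeasure ν
  meas : Measurable g
  bound : ∀ s, ‖g s‖ ≤ 1
  incr : ∀ s t, 0 ≤ s → s ≤ t → t ≤ T → φ t - φ s = ∫ r in Ioc s t, g r ∂ν
  var : ∀ s t, 0 ≤ s → s ≤ t → t ≤ T → ν.real (Ioc s t) = totalVar φ s t
  cone : ∀ s ∈ Icc (0:ℝ) T, g s ≠ 0 → ξ s ∈ frontier D ∧ g s ∈ normalCone D (ξ s)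
  mem : ∀ s ∈ Icc (0:ℝ) T, ξ s ∈ closure D
  zero : φ 0 = 0
  cont : ContinuousOn φ (Icc 0 T)

theorem norm_of_mem_normalCone {D : Set (EuclideanSpace ℝ (Fin d))}
    {x v : EuclideanSpace ℝ (Fin d)} (h : v ∈ normalCone D x) : ‖v‖ = 1 := by
  simp only [normalCone, mem_iUnion] at h
  obtain ⟨r, hr, h⟩ := h
  exact h.1

theorem SkorohodSol.data {D : Set (EuclideanSpace ℝ (Fin d))} {T : ℝ} (hT : 0 < T)
    {w ξ φ : ℝ → EuclideanSpace ℝ (Fin d)} (h : SkorohodSol D 0 T w ξ φ) :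
    ∃ g ν, SkData D T ξ φ g ν := by
  obtain ⟨nv, μ, hnv, hcone, hμ, hφ⟩ := h.localTime
  set K : Set ℝ := Icc 0 T ∩ ξ ⁻¹' (frontier D) with hK
  have hKc : IsClosed K := h.xi_cont.preimage_isClosed_of_isClosed isClosed_Icc isClosed_frontier
  set g : ℝ → EuclideanSpace ℝ (Fin d) := K.indicator nv with hg
  have hgm : Measurable g := hnv.indicator hKc.measurableSet
  have hgG : ∀ s ∈ Icc (0:ℝ) T,
      (frontier D).indicator (fun _ => (1 : ℝ)) (ξ s) • nv s = g s := by
    intro s hs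
    by_cases hf : ξ s ∈ frontier D
    · have : s ∈ K := ⟨hs, hf⟩
      simp [hg, hf, this]
    · have : s ∉ K := fun h => hf h.2
      simp [hg, hf, this]
  have hgc : ∀ s ∈ Icc (0:ℝ) T, g s ≠ 0 → ξ s ∈ frontier D ∧ g s ∈ normalCone D (ξ s) := by
    intro s hs h0
    by_cases hk : s ∈ K
    · refine ⟨hk.2, ?_⟩
      rw [hg, indicator_of_mem hk]
      exact hcone s hs hk.2
    · exact absurd (indicator_of_notMem hk _) h0
  have hgb : ∀ s, ‖g s‖ ≤ 1 := by
    intro s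
    by_cases hk : s ∈ K
    · rw [hg, indicator_of_mem hk]
      exact (norm_of_mem_normalCone (hcone s hk.1 hk.2)).le
    · rw [hg, indicator_of_notMem hk]; simp
  set ν := μ.restrict (Ioc 0 T) with hν
  have hfin : IsFiniteMeasure ν := ⟨by
    rw [hν, Measure.restrict_apply_univ, hμ 0 T le_rfl hT.le le_rfl]; exact ENNReal.ofReal_lt_top⟩
  have hgi : Integrable g ν :=
    Integrable.of_bound hgm.aestronglyMeasurable 1 (Filter.Eventually.of_forall hgb)
  have hsub : ∀ s t, 0 ≤ s → t ≤ T → ν.restrict (Ioc s t) = μ.restrict (Ioc s t) := by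
    intro s t hs ht
    rw [hν, Measure.restrict_restrict measurableSet_Ioc,
      inter_eq_left.2 (Ioc_subset_Ioc hs ht)]
  have hφ' : ∀ t ∈ Icc (0:ℝ) T, φ t = ∫ s in Icc 0 t, g s ∂μ := by
    intro t ht
    rw [hφ t ht]
    exact setIntegral_congr_fun measurableSet_Icc (fun s hs => hgG s ⟨hs.1, hs.2.trans ht.2⟩)
  have key : ∀ t ∈ Icc (0:ℝ) T, φ t = ∫ r in Ioc 0 t, g r ∂ν := by
    by_cases hi : IntegrableOn g {0} μ
    · intro t ht
      rw [hφ' t ht, ← Ioc_union_left ht.1, setIntegral_union (by simp)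
        (measurableSet_singleton 0) ?_ hi, hsub 0 t le_rfl ht.2]
      · have := hφ' 0 ⟨le_rfl, hT.le⟩
        rw [Icc_self] at this
        rw [← this, h.phi_start, add_zero]
      · have := hgi.integrableOn (s := Ioc 0 t)
        rwa [IntegrableOn, hsub 0 t le_rfl ht.2] at this
    · have h0 : ∀ t ∈ Icc (0:ℝ) T, φ t = 0 := by
        intro t ht
        rw [hφ' t ht]
        apply integral_undef
        intro hc
        exact hi (IntegrableOn.mono_set hc (by simpa using ht.1))
      have hv : eVariationOn φ (Icc 0 T) = 0 := by
        rw [eVariationOn.eq_zero_iff]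
        intro a ha b hb
        rw [h0 a ha, h0 b hb, edist_self]
      have hz : μ (Ioc 0 T) = 0 := by
        rw [hμ 0 T le_rfl hT.le le_rfl, totalVar, hv]; simp
      have : ν = 0 := by rw [hν, Measure.restrict_eq_zero, hz]
      intro t ht
      rw [h0 t ht, this]; simp
  refine ⟨g, ν, hfin, hgm, hgb, ?_, ?_, hgc, h.xi_mem, h.phi_start, h.phi_cont⟩
  · intro s t hs hst ht
    rw [key t ⟨hs.trans hst, ht⟩, key s ⟨hs, hst.trans ht⟩, ← Ioc_union_Ioc_eq_Ioc hs hst,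
      setIntegral_union (Ioc_disjoint_Ioc_of_le le_rfl) measurableSet_Ioc
        hgi.integrableOn hgi.integrableOn, add_sub_cancel_left]
  · intro s t hs hst ht
    rw [Measure.real, hν, Measure.restrict_apply measurableSet_Ioc,
      inter_eq_left.2 (Ioc_subset_Ioc hs ht), hμ s t hs hst ht,
      ENNReal.toReal_ofReal (show 0 ≤ totalVar φ s t from ENNReal.toReal_nonneg)]

namespace SkData

variable {D : Set (EuclideanSpace ℝ (Fin d))} {T : ℝ}
  {ξ φ g : ℝ → EuclideanSpace ℝ (Fin d)} {ν : Measure ℝ}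

theorem integrable (h : SkData D T ξ φ g ν) : Integrable g ν := by
  have := h.fin
  exact Integrable.of_bound h.meas.aestronglyMeasurable 1 (Filter.Eventually.of_forall h.bound)

theorem var_add (h : SkData D T ξ φ g ν) {s t u : ℝ} (hst : s ≤ t) (htu : t ≤ u) :
    ν.real (Ioc s u) = ν.real (Ioc s t) + ν.real (Ioc t u) := by
  have := h.fin
  rw [← Ioc_union_Ioc_eq_Ioc hst htu,
    measureReal_union (Ioc_disjoint_Ioc_of_le le_rfl) measurableSet_Ioc]

theorem var_mono (h : SkData D T ξ φ g ν) {s t s' t' : ℝ} (hs : s ≤ s') (ht : t' ≤ t) :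
    ν.real (Ioc s' t') ≤ ν.real (Ioc s t) := by
  have := h.fin
  exact measureReal_mono (Ioc_subset_Ioc hs ht)

theorem incr_le (h : SkData D T ξ φ g ν) {s t : ℝ} (hs : 0 ≤ s) (hst : s ≤ t) (ht : t ≤ T) :
    ‖φ t - φ s‖ ≤ ν.real (Ioc s t) := by
  have := h.fin
  rw [h.incr s t hs hst ht]
  have := norm_setIntegral_le_of_norm_le_const (μ := ν) (s := Ioc s t) (f := g) (C := 1)
    (measure_lt_top _ _) (fun r _ => h.bound r)
  simpa using this

theorem norm_le (h : SkData D T ξ φ g ν) {t : ℝ} (hs : 0 ≤ t) (ht : t ≤ T) :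
    ‖φ t‖ ≤ ν.real (Ioc 0 t) := by
  have := h.incr_le le_rfl hs ht
  rwa [h.zero, sub_zero] at this

theorem integrableOn_tensor (h : SkData D T ξ φ g ν) {x : ℝ → EuclideanSpace ℝ (Fin n)}
    (hx : ContinuousOn x (Icc 0 T)) {a b : ℝ} (ha : 0 ≤ a) (hb : b ≤ T) :
    IntegrableOn (fun r => tensorB d n (g r) (x r)) (Ioc a b) ν := by
  have := h.fin
  obtain ⟨K, hK, hxK⟩ := bdd_of_cont hx
  have hsub : Ioc a b ⊆ Icc 0 T := fun r hr => ⟨ha.trans hr.1.le, hr.2.trans hb⟩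
  have hxm : AEStronglyMeasurable x (ν.restrict (Ioc a b)) :=
    (hx.mono hsub).aestronglyMeasurable measurableSet_Ioc
  refine Integrable.of_bound (C := K) ?_ ?_
  · exact (tensorB d n).aestronglyMeasurable_comp₂ h.meas.aestronglyMeasurable hxm
  · refine (ae_restrict_iff' measurableSet_Ioc).2 (Filter.Eventually.of_forall fun r hr => ?_)
    rw [norm_tensorB]
    calc ‖g r‖ * ‖x r‖ ≤ 1 * K :=
          mul_le_mul (h.bound r) (hxK r (hsub hr)) (norm_nonneg _) zero_le_one
      _ = K := one_mul K

/-- integral of `g ⊗ (x r - c)` -/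
theorem norm_int_tensor_le (h : SkData D T ξ φ g ν) {x : ℝ → EuclideanSpace ℝ (Fin n)}
    (hx : ContinuousOn x (Icc 0 T)) {a b ω : ℝ} (ha : 0 ≤ a) (hab : a ≤ b) (hb : b ≤ T)
    (c : EuclideanSpace ℝ (Fin n)) (hω : ∀ r ∈ Icc a b, ‖x r - c‖ ≤ ω) :
    ‖(∫ r in Ioc a b, tensorB d n (g r) (x r) ∂ν) - tensorB d n (φ b - φ a) c‖
      ≤ ω * ν.real (Ioc a b) := by
  have := h.fin
  have h1 : tensorB d n (φ b - φ a) c = ∫ r in Ioc a b, tensorB d n (g r) c ∂ν := by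
    rw [h.incr a b ha hab hb]
    have := ((tensorB d n).flip c).integral_comp_comm (h.integrable.integrableOn (s := Ioc a b))
    simpa using this.symm
  have h2 : IntegrableOn (fun r => tensorB d n (g r) c) (Ioc a b) ν := by
    have := ((tensorB d n).flip c).integrable_comp (h.integrable.integrableOn (s := Ioc a b))
    exact this
  rw [h1, ← integral_sub (h.integrableOn_tensor hx ha hb) h2]
  refine norm_setIntegral_le_of_norm_le_const (measure_lt_top _ _) (fun r hr => ?_)
  rw [← map_sub, norm_tensorB]
  calc ‖g r‖ * ‖x r - c‖ ≤ 1 * ω :=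
        mul_le_mul (h.bound r) (hω r ⟨hr.1.le, hr.2⟩) (norm_nonneg _) zero_le_one
    _ = ω := one_mul ω

/-- Riemann sums versus the integrated-by-parts integral. -/
theorem rs_bound (h : SkData D T ξ φ g ν) {x : ℝ → EuclideanSpace ℝ (Fin n)}
    (hx : ContinuousOn x (Icc 0 T)) {ω : ℝ} (t : ℕ → ℝ) (ht : Monotone t) (h0 : 0 ≤ t 0)
    (N : ℕ) (hN : t N ≤ T)
    (hω : ∀ k < N, ∀ r ∈ Icc (t k) (t (k+1)), ‖x r - x (t (k+1))‖ ≤ ω) :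
    ‖(∑ k ∈ Finset.range N, tensorB d n (φ (t k)) (x (t (k+1)) - x (t k)))
      - (tensorB d n (φ (t N)) (x (t N)) - tensorB d n (φ (t 0)) (x (t 0))
        - ∫ r in Ioc (t 0) (t N), tensorB d n (g r) (x r) ∂ν)‖
      ≤ ω * ν.real (Ioc (t 0) (t N)) := by
  induction N with
  | zero => simp
  | succ N ih =>
    have hle : t N ≤ t (N+1) := ht (Nat.le_succ N)
    have h0N : t 0 ≤ t N := ht (Nat.zero_le N)
    have ih' := ih (hle.trans hN) (fun k hk => hω k (hk.trans (Nat.lt_succ_self N)))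
    have h1 := h.norm_int_tensor_le hx (h0.trans h0N) hle hN (x (t (N+1)))
      (hω N (Nat.lt_succ_self N))
    rw [Finset.sum_range_succ, h.var_add h0N hle, mul_add, ← Ioc_union_Ioc_eq_Ioc h0N hle,
      setIntegral_union (Ioc_disjoint_Ioc_of_le le_rfl) measurableSet_Ioc
        (h.integrableOn_tensor hx h0 (hle.trans hN))
        (h.integrableOn_tensor hx (h0.trans h0N) hN)]
    refine le_trans (le_of_eq ?_) ((norm_add_le _ _).trans (add_le_add ih' h1))
    congr 1
    simp only [map_sub, sub_apply]
    abel

theorem rs_norm_le (h : SkData D T ξ φ g ν) {x : ℝ → EuclideanSpace ℝ (Fin n)}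
    (hx : ContinuousOn x (Icc 0 T)) {ω : ℝ} (t : ℕ → ℝ) (ht : Monotone t) (h0 : 0 ≤ t 0)
    (N : ℕ) (hN : t N ≤ T)
    (hω : ∀ u ∈ Icc (t 0) (t N), ∀ v ∈ Icc (t 0) (t N), ‖x u - x v‖ ≤ ω) :
    ‖∑ k ∈ Finset.range N, tensorB d n (φ (t k)) (x (t (k+1)) - x (t k))‖
      ≤ ω * (‖φ (t 0)‖ + 2 * ν.real (Ioc (t 0) (t N))) := by
  have h0N : t 0 ≤ t N := ht (Nat.zero_le N)
  have h1 := h.rs_bound hx t ht h0 N hN (ω := ω) (by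
    intro k hk r hr
    exact hω r ⟨(ht (Nat.zero_le k)).trans hr.1, hr.2.trans (ht hk)⟩ _
      ⟨ht (Nat.zero_le _), ht hk⟩)
  have h2 := h.norm_int_tensor_le hx h0 h0N hN (x (t N))
    (fun r hr => hω r hr _ ⟨h0N, le_rfl⟩)
  have h3 : ‖tensorB d n (φ (t 0)) (x (t N) - x (t 0))‖ ≤ ‖φ (t 0)‖ * ω := by
    rw [norm_tensorB]
    exact mul_le_mul_of_nonneg_left (hω _ ⟨h0N, le_rfl⟩ _ ⟨le_rfl, h0N⟩) (norm_nonneg _)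
  have h4 := (norm_add_le _ _).trans (add_le_add h1 ((norm_sub_le _ _).trans (add_le_add h3 h2)))
  refine le_trans (le_of_eq ?_) (h4.trans (le_of_eq (by ring)))
  congr 1
  simp only [map_sub, sub_apply]
  abel

end SkData

theorem sphere_ineq {D : Set (EuclideanSpace ℝ (Fin d))} {r₀ : ℝ} (hA : CondA D r₀)
    {a b v : EuclideanSpace ℝ (Fin d)} (ha : a ∈ frontier D) (hv : v ∈ normalCone D a)
    (hb : b ∈ closure D) : ⟪a - b, v⟫ ≤ ‖a - b‖ ^ 2 / (2 * r₀) := by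
  have hr := hA.1
  have hv' := hv
  rw [(hA.2 a ha).1] at hv'
  have hnb : b ∉ Metric.ball (a - r₀ • v) r₀ := by
    intro hc
    obtain ⟨y, hy⟩ := mem_closure_iff.1 hb _ Metric.isOpen_ball hc
    rw [hv'.2] at hy
    exact hy
  rw [Metric.mem_ball, not_lt, dist_eq_norm] at hnb
  have h1 : b - (a - r₀ • v) = r₀ • v - (a - b) := by abel
  rw [h1] at hnb
  have h2 : r₀ ^ 2 ≤ ‖r₀ • v - (a - b)‖ ^ 2 := by gcongr
  rw [norm_sub_sq_real, norm_smul, hv'.1, real_inner_smul_left, real_inner_comm,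
    Real.norm_of_nonneg hr.le] at h2
  rw [le_div_iff₀ (by positivity)]
  nlinarith

namespace SkData

variable {D : Set (EuclideanSpace ℝ (Fin d))} {T : ℝ}
  {ξ φ g : ℝ → EuclideanSpace ℝ (Fin d)} {ν : Measure ℝ}
  {ξ' φ' g' : ℝ → EuclideanSpace ℝ (Fin d)} {ν' : Measure ℝ}

theorem half (h : SkData D T ξ φ g ν) {r₀ : ℝ} (hA : CondA D r₀) {s t R E : ℝ}
    (hs : 0 ≤ s) (hst : s ≤ t) (ht : t ≤ T)
    (hE0 : 0 ≤ E) (c : EuclideanSpace ℝ (Fin d))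
    (hmem : ∀ r ∈ Icc (0:ℝ) T, ξ' r ∈ closure D)
    (hE : ∀ r ∈ Icc s t, ‖(ξ r - ξ' r) - c‖ ≤ E)
    (hR : ∀ r ∈ Icc s t, ‖ξ r - ξ' r‖ ≤ R) :
    ⟪c, φ t - φ s⟫ ≤ (R ^ 2 / (2 * r₀) + E) * ν.real (Ioc s t) := by
  have := h.fin
  have hr := hA.1
  rw [h.incr s t hs hst ht]
  have h1 : ⟪c, ∫ r in Ioc s t, g r ∂ν⟫ = ∫ r in Ioc s t, ⟪c, g r⟫ ∂ν :=
    ((innerSL ℝ c).integral_comp_comm (h.integrable.integrableOn (s := Ioc s t))).symm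
  have h2 : IntegrableOn (fun r => ⟪c, g r⟫) (Ioc s t) ν :=
    (innerSL ℝ c).integrable_comp (h.integrable.integrableOn (s := Ioc s t))
  rw [h1]
  have h3 : ∫ r in Ioc s t, ⟪c, g r⟫ ∂ν ≤ ∫ r in Ioc s t, (R ^ 2 / (2 * r₀) + E) ∂ν := by
    refine setIntegral_mono_on h2 (integrable_const _) measurableSet_Ioc (fun r hr' => ?_)
    have hr1 : r ∈ Icc s t := ⟨hr'.1.le, hr'.2⟩
    have hrT : r ∈ Icc 0 T := ⟨hs.trans hr1.1, hr1.2.trans ht⟩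
    by_cases hg : g r = 0
    · rw [hg, inner_zero_right]; positivity
    · obtain ⟨hf, hn⟩ := h.cone r hrT hg
      have h4 := sphere_ineq hA hf hn (hmem r hrT)
      have h5 : ‖ξ r - ξ' r‖ ^ 2 / (2 * r₀) ≤ R ^ 2 / (2 * r₀) := by
        have := hR r hr1
        gcongr
      have h6 : -⟪(ξ r - ξ' r) - c, g r⟫ ≤ E := by
        have := (abs_le.1 (abs_real_inner_le_norm ((ξ r - ξ' r) - c) (g r))).1
        have h7 : ‖(ξ r - ξ' r) - c‖ * ‖g r‖ ≤ E * 1 :=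
          mul_le_mul (hE r hr1) (h.bound r) (norm_nonneg _) hE0
        linarith
      rw [inner_sub_left] at h6
      linarith
  refine h3.trans (le_of_eq ?_)
  rw [setIntegral_const, smul_eq_mul, mul_comm]

theorem energy_local (h : SkData D T ξ φ g ν) (h' : SkData D T ξ' φ' g' ν')
    {r₀ : ℝ} (hA : CondA D r₀) {s t S E ε : ℝ}
    (hs : 0 ≤ s) (hst : s ≤ t) (ht : t ≤ T) (hε : 0 ≤ ε)
    (hE : ∀ r ∈ Icc s t, ‖(ξ r - ξ' r) - (φ r - φ' r)‖ ≤ E)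
    (hS : ∀ r ∈ Icc s t, ‖φ r - φ' r‖ ≤ S)
    (hosc : ∀ r ∈ Icc s t, ‖(φ r - φ' r) - (φ t - φ' t)‖ ≤ ε) :
    ‖φ t - φ' t‖ ^ 2 - ‖φ s - φ' s‖ ^ 2 ≤
      2 * ((S + E) ^ 2 / (2 * r₀) + (E + ε)) * (ν.real (Ioc s t) + ν'.real (Ioc s t)) := by
  have hE0 : 0 ≤ E := (norm_nonneg _).trans (hE s ⟨le_rfl, hst⟩)
  have hR : ∀ r ∈ Icc s t, ‖ξ r - ξ' r‖ ≤ S + E := by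
    intro r hr
    have h1 : ξ r - ξ' r = (φ r - φ' r) + ((ξ r - ξ' r) - (φ r - φ' r)) := by abel
    rw [h1]
    exact (norm_add_le _ _).trans (add_le_add (hS r hr) (hE r hr))
  have hc : ∀ r ∈ Icc s t, ‖(ξ r - ξ' r) - (φ t - φ' t)‖ ≤ E + ε := by
    intro r hr
    have h1 : (ξ r - ξ' r) - (φ t - φ' t) = ((ξ r - ξ' r) - (φ r - φ' r)) +
      ((φ r - φ' r) - (φ t - φ' t)) := by abel
    rw [h1]
    exact (norm_add_le _ _).trans (add_le_add (hE r hr) (hosc r hr))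
  have h1 := h.half hA hs hst ht (add_nonneg hE0 hε) (φ t - φ' t) h'.mem hc hR
  have h2 := h'.half (ξ' := ξ) (R := S + E) hA hs hst ht (add_nonneg hE0 hε) (-(φ t - φ' t)) h.mem
    (by
      intro r hr
      rw [← norm_neg]
      refine le_trans (le_of_eq ?_) (hc r hr)
      congr 1; abel)
    (by intro r hr; rw [norm_sub_rev]; exact hR r hr)
  have h3 : ‖φ t - φ' t‖ ^ 2 - ‖φ s - φ' s‖ ^ 2 ≤
      2 * ⟪φ t - φ' t, (φ t - φ' t) - (φ s - φ' s)⟫ := by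
    have h4 := norm_sub_sq_real (φ t - φ' t) (φ s - φ' s)
    have h5 := sq_nonneg ‖(φ t - φ' t) - (φ s - φ' s)‖
    rw [inner_sub_right (φ t - φ' t) (φ t - φ' t), real_inner_self_eq_norm_sq]
    linarith
  have h6 : ⟪φ t - φ' t, (φ t - φ' t) - (φ s - φ' s)⟫ =
      ⟪φ t - φ' t, φ t - φ s⟫ + ⟪-(φ t - φ' t), φ' t - φ' s⟫ := by
    rw [inner_neg_left, ← sub_eq_add_neg, ← inner_sub_right]
    congr 1; abel
  rw [h6] at h3
  linarith

theorem energy (h : SkData D T ξ φ g ν) (h' : SkData D T ξ' φ' g' ν')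
    {r₀ : ℝ} (hA : CondA D r₀) {s t S E : ℝ}
    (hs : 0 ≤ s) (hst : s ≤ t) (ht : t ≤ T)
    (hE : ∀ r ∈ Icc s t, ‖(ξ r - ξ' r) - (φ r - φ' r)‖ ≤ E)
    (hS : ∀ r ∈ Icc s t, ‖φ r - φ' r‖ ≤ S) :
    ‖φ t - φ' t‖ ^ 2 - ‖φ s - φ' s‖ ^ 2 ≤
      2 * ((S + E) ^ 2 / (2 * r₀) + E) * (ν.real (Ioc s t) + ν'.real (Ioc s t)) := by
  have hm : 0 ≤ ν.real (Ioc s t) + ν'.real (Ioc s t) := by positivity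
  apply le_of_forall_pos_le_add
  intro e he
  set m := ν.real (Ioc s t) + ν'.real (Ioc s t) with hmdef
  set ε := e / (2 * m + 1) with hεdef
  have hε : 0 < ε := by positivity
  obtain ⟨δ, hδ, hmod⟩ := unif_mod (h.cont.sub h'.cont) hε
  obtain ⟨N, hN⟩ := exists_nat_gt ((t - s) / δ)
  have hN0 : 0 < (N:ℝ) := lt_of_le_of_lt (div_nonneg (sub_nonneg.2 hst) hδ.le) hN
  have hstep : (t - s) / N ≤ δ := by
    rw [div_lt_iff₀ hδ] at hN
    rw [div_le_iff₀ hN0]; linarith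
  have hstep0 : 0 ≤ (t - s) / N := div_nonneg (sub_nonneg.2 hst) hN0.le
  have hle : ∀ k : ℕ, k ≤ N → s + k * ((t - s) / N) ≤ t := by
    intro k hk
    have : (k:ℝ) * ((t - s) / N) ≤ N * ((t - s) / N) :=
      mul_le_mul_of_nonneg_right (by exact_mod_cast hk) hstep0
    rw [mul_div_cancel₀ _ hN0.ne'] at this
    linarith
  have claim : ∀ k : ℕ, k ≤ N →
      ‖φ (s + k * ((t - s) / N)) - φ' (s + k * ((t - s) / N))‖ ^ 2 - ‖φ s - φ' s‖ ^ 2 ≤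
      2 * ((S + E) ^ 2 / (2 * r₀) + (E + ε)) * (ν.real (Ioc s (s + k * ((t - s) / N))) +
        ν'.real (Ioc s (s + k * ((t - s) / N)))) := by
    intro k
    induction k with
    | zero => intro _; simp
    | succ k ih =>
      intro hk
      have ih' := ih (Nat.le_of_succ_le hk)
      set a := s + k * ((t - s) / N) with ha
      have hb : s + ((k+1 : ℕ):ℝ) * ((t - s) / N) = a + (t - s) / N := by
        rw [ha]; push_cast; ring
      have hbt := hle (k+1) hk
      rw [hb] at hbt ⊢
      have hsa : s ≤ a := by
        have : 0 ≤ (k:ℝ) * ((t - s) / N) := by positivity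
        linarith
      have hab : a ≤ a + (t - s) / N := by linarith
      have := energy_local h h' hA (ε := ε) (S := S) (E := E) (hs.trans hsa) hab (hbt.trans ht)
        hε.le (fun r hr => hE r ⟨hsa.trans hr.1, hr.2.trans hbt⟩)
        (fun r hr => hS r ⟨hsa.trans hr.1, hr.2.trans hbt⟩)
        (fun r hr => hmod r ⟨hs.trans (hsa.trans hr.1), hr.2.trans (hbt.trans ht)⟩ _
          ⟨hs.trans (hsa.trans hab), hbt.trans ht⟩ (by
            rw [abs_le]; constructor <;> linarith [hr.1, hr.2]))
      rw [h.var_add hsa hab, h'.var_add hsa hab]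
      linarith
  have hfin := claim N le_rfl
  have hNt : s + N * ((t - s) / N) = t := by rw [mul_div_cancel₀ _ hN0.ne']; ring
  rw [hNt, ← hmdef] at hfin
  refine hfin.trans ?_
  have h7 : ε * (2 * m + 1) = e := by rw [hεdef]; field_simp
  nlinarith

theorem step (h : SkData D T ξ φ g ν) (h' : SkData D T ξ' φ' g' ν')
    {r₀ : ℝ} (hA : CondA D r₀) {s t E : ℝ}
    (hs : 0 ≤ s) (hst : s ≤ t) (ht : t ≤ T)
    (hE : ∀ r ∈ Icc s t, ‖(ξ r - ξ' r) - (φ r - φ' r)‖ ≤ E)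
    (hm : ν.real (Ioc s t) + ν'.real (Ioc s t) ≤ r₀ / 4) :
    ∀ r ∈ Icc s t, ‖φ r - φ' r‖ ^ 2 ≤ 2 * ‖φ s - φ' s‖ ^ 2 + (E ^ 2 + r₀ * E) := by
  have hr0 := hA.1
  have hE0 : 0 ≤ E := (norm_nonneg _).trans (hE s ⟨le_rfl, hst⟩)
  have hcont : ContinuousOn (fun r => ‖φ r - φ' r‖) (Icc s t) :=
    ((h.cont.sub h'.cont).norm).mono (Icc_subset_Icc hs ht)
  obtain ⟨q, hq, hmax⟩ := isCompact_Icc.exists_isMaxOn (nonempty_Icc.2 hst) hcont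
  have hmax' : ∀ r ∈ Icc s t, ‖φ r - φ' r‖ ≤ ‖φ q - φ' q‖ := fun r hr => hmax hr
  set S := ‖φ q - φ' q‖ with hS
  have hS0 : 0 ≤ S := norm_nonneg _
  have h1 := energy h h' hA (S := S) (E := E) hs hq.1 (hq.2.trans ht)
    (fun r hr => hE r ⟨hr.1, hr.2.trans hq.2⟩) (fun r hr => hmax' r ⟨hr.1, hr.2.trans hq.2⟩)
  have hm' : ν.real (Ioc s q) + ν'.real (Ioc s q) ≤ r₀ / 4 :=
    (add_le_add (h.var_mono le_rfl hq.2) (h'.var_mono le_rfl hq.2)).trans hm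
  have h2 : 2 * ((S + E) ^ 2 / (2 * r₀) + E) * (ν.real (Ioc s q) + ν'.real (Ioc s q)) ≤
      2 * ((S + E) ^ 2 / (2 * r₀) + E) * (r₀ / 4) :=
    mul_le_mul_of_nonneg_left hm' (by positivity)
  have h3 : 2 * ((S + E) ^ 2 / (2 * r₀) + E) * (r₀ / 4) = (S + E) ^ 2 / 4 + E * r₀ / 2 := by
    field_simp
    ring
  have h4 : S ^ 2 ≤ 2 * ‖φ s - φ' s‖ ^ 2 + (E ^ 2 + r₀ * E) := by
    nlinarith [sq_nonneg (S - E)]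
  intro r hr
  have h5 : ‖φ r - φ' r‖ ^ 2 ≤ S ^ 2 := by
    have := hmax' r hr
    gcongr
  exact h5.trans h4

end SkData

/-- Grid points. -/
def gp (T : ℝ) (M j : ℕ) : ℝ := j * T / M

theorem gp_zero (T : ℝ) (M : ℕ) : gp T M 0 = 0 := by simp [gp]

theorem gp_self (T : ℝ) {M : ℕ} (hM : 0 < M) : gp T M M = T := by
  have : (M:ℝ) ≠ 0 := by positivity
  rw [gp]; field_simp

theorem gp_mono {T : ℝ} (hT : 0 < T) (M : ℕ) : Monotone (gp T M) := by
  intro i j hij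
  have : (i:ℝ) ≤ j := by exact_mod_cast hij
  unfold gp
  gcongr

theorem gp_nonneg {T : ℝ} (hT : 0 < T) (M j : ℕ) : 0 ≤ gp T M j := by
  unfold gp; positivity

theorem gp_le {T : ℝ} (hT : 0 < T) {M j : ℕ} (hM : 0 < M) (hj : j ≤ M) : gp T M j ≤ T :=
  (gp_mono hT M hj).trans_eq (gp_self T hM)

theorem gp_succ (T : ℝ) (M j : ℕ) : gp T M (j+1) = gp T M j + T / M := by
  unfold gp; push_cast; ring

theorem gp_mul (T : ℝ) (M m j : ℕ) (hm : 0 < m) : gp T (M * m) (j * m) = gp T M j := by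
  have : (m:ℝ) ≠ 0 := by positivity
  unfold gp; push_cast
  rw [mul_right_comm, mul_div_mul_right _ _ this]

theorem exists_grid (T : ℝ) {δ : ℝ} (hδ : 0 < δ) : ∃ M : ℕ, 0 < M ∧ T / M ≤ δ := by
  obtain ⟨N, hN⟩ := exists_nat_gt (T / δ)
  refine ⟨N + 1, Nat.succ_pos N, ?_⟩
  have : (0:ℝ) < ((N+1:ℕ):ℝ) := by positivity
  rw [div_le_iff₀ this]
  rw [div_lt_iff₀ hδ] at hN
  push_cast
  nlinarith

theorem SkorohodSol.w_cont {D : Set (EuclideanSpace ℝ (Fin d))} {T : ℝ}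
    {w ξ φ : ℝ → EuclideanSpace ℝ (Fin d)} (h : SkorohodSol D 0 T w ξ φ) :
    ContinuousOn w (Icc 0 T) :=
  (h.xi_cont.sub h.phi_cont).congr (fun t ht => by simp [h.eqn t ht])

theorem SkorohodSol.var_le {D : Set (EuclideanSpace ℝ (Fin d))} {T C_D : ℝ} (hT : 0 < T)
    (hH1 : CondH1 D T C_D)
    {w ξ φ : ℝ → EuclideanSpace ℝ (Fin d)} (h : SkorohodSol D 0 T w ξ φ) {s t K : ℝ}
    (hs : 0 ≤ s) (hst : s ≤ t) (ht : t ≤ T) (hK : 0 ≤ K)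
    (hw : ∀ u ∈ Icc s t, ∀ v ∈ Icc s t, ‖w u - w v‖ ≤ K) : totalVar φ s t ≤ C_D * K := by
  have h0 : w 0 ∈ closure D := by
    have := h.eqn 0 ⟨le_rfl, hT.le⟩
    rw [h.phi_start, add_zero] at this
    rw [← this]
    exact h.xi_mem 0 ⟨le_rfl, hT.le⟩
  refine ((hH1.2.2 0 T le_rfl hT.le le_rfl w h.w_cont h0).2.2 ξ φ h s t hs hst ht).trans ?_
  refine mul_le_mul_of_nonneg_left ?_ hH1.2.1.le
  refine Real.sSup_le ?_ hK
  rintro _ ⟨q, hq, rfl⟩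
  exact hw _ ⟨hq.1.trans hq.2.1, hq.2.2⟩ _ ⟨hq.1, hq.2.1.trans hq.2.2⟩

/-- Continuity of the Skorohod map. -/
theorem skorohod_cont {D : Set (EuclideanSpace ℝ (Fin d))} {T C_D : ℝ} (hT : 0 < T)
    (hH1 : CondH1 D T C_D)
    {w ξ φ : ℝ → EuclideanSpace ℝ (Fin d)} (h : SkorohodSol D 0 T w ξ φ) {ε : ℝ} (hε : 0 < ε) :
    ∃ κ > 0, ∀ w' ξ' φ' : ℝ → EuclideanSpace ℝ (Fin d), SkorohodSol D 0 T w' ξ' φ' →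
      (∀ t ∈ Icc (0:ℝ) T, ‖w t - w' t‖ ≤ κ) → ∀ t ∈ Icc (0:ℝ) T, ‖φ t - φ' t‖ ≤ ε := by
  obtain ⟨r₀, hA⟩ := hH1.1
  have hr0 := hA.1
  have hC := hH1.2.1
  obtain ⟨δ, hδ, hmod⟩ := unif_mod h.w_cont (ε := r₀ / (16 * C_D)) (by positivity)
  obtain ⟨M, hM, hMδ⟩ := exists_grid T hδ
  have hTM : 0 < T / M := by positivity
  set κ := min 1 (min (r₀ / (16 * C_D)) (ε ^ 2 / (2 ^ M * (1 + r₀)))) with hκ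
  have hκ0 : 0 < κ := by positivity
  have hκ1 : κ ≤ 1 := min_le_left _ _
  have hκ2 : κ ≤ r₀ / (16 * C_D) := (min_le_right _ _).trans (min_le_left _ _)
  have hκ3 : κ ≤ ε ^ 2 / (2 ^ M * (1 + r₀)) := (min_le_right _ _).trans (min_le_right _ _)
  refine ⟨κ, hκ0, fun w' ξ' φ' h' hww => ?_⟩
  obtain ⟨g, ν, hd⟩ := h.data hT
  obtain ⟨g', ν', hd'⟩ := h'.data hT
  set c := κ ^ 2 + r₀ * κ with hc
  have hc0 : 0 ≤ c := by positivity
  have hE : ∀ r ∈ Icc (0:ℝ) T, ‖(ξ r - ξ' r) - (φ r - φ' r)‖ ≤ κ := by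
    intro r hr
    refine le_trans (le_of_eq ?_) (hww r hr)
    rw [h.eqn r hr, h'.eqn r hr]
    congr 1; abel
  have claim : ∀ j : ℕ, j ≤ M → ∀ r ∈ Icc 0 (gp T M j),
      ‖φ r - φ' r‖ ^ 2 ≤ (2 ^ j - 1) * c := by
    intro j
    induction j with
    | zero =>
      intro _ r hr
      rw [gp_zero, Icc_self, mem_singleton_iff] at hr
      rw [hr, hd.zero, hd'.zero]; simp
    | succ j ih =>
      intro hj r hr
      have ih' := ih (Nat.le_of_succ_le hj)
      have hjT := gp_le hT hM hj
      have hmono := gp_mono hT M (Nat.le_succ j)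
      have hpow : (1:ℝ) ≤ 2 ^ j := one_le_pow₀ (by norm_num)
      have hfinal : 2 * ((2 ^ j - 1) * c) + c = (2 ^ (j+1) - 1) * c := by ring
      rcases le_total r (gp T M j) with hrj | hrj
      · refine (ih' r ⟨hr.1, hrj⟩).trans ?_
        rw [← hfinal]
        have : 0 ≤ (2 ^ j - 1) * c := mul_nonneg (by linarith) hc0
        linarith
      · have hw1 : ∀ u ∈ Icc (gp T M j) (gp T M (j+1)), ∀ v ∈ Icc (gp T M j) (gp T M (j+1)),
            ‖w u - w v‖ ≤ r₀ / (16 * C_D) := by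
          intro u hu v hv
          refine hmod u ⟨(gp_nonneg hT M j).trans hu.1, hu.2.trans hjT⟩ v
            ⟨(gp_nonneg hT M j).trans hv.1, hv.2.trans hjT⟩ ?_
          rw [gp_succ] at hu hv
          rw [abs_le]; constructor <;> linarith [hu.1, hu.2, hv.1, hv.2]
        have hw2 : ∀ u ∈ Icc (gp T M j) (gp T M (j+1)), ∀ v ∈ Icc (gp T M j) (gp T M (j+1)),
            ‖w' u - w' v‖ ≤ 3 * (r₀ / (16 * C_D)) := by
          intro u hu v hv
          have e1 := hww u ⟨(gp_nonneg hT M j).trans hu.1, hu.2.trans hjT⟩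
          have e2 := hww v ⟨(gp_nonneg hT M j).trans hv.1, hv.2.trans hjT⟩
          have e3 := hw1 u hu v hv
          have : w' u - w' v = (w u - w v) - (w u - w' u) + (w v - w' v) := by abel
          rw [this]
          have e4 := norm_add_le ((w u - w v) - (w u - w' u)) (w v - w' v)
          have e5 := norm_sub_le (w u - w v) (w u - w' u)
          linarith
        have v1 := h.var_le hT hH1 (gp_nonneg hT M j) hmono hjT (by positivity) hw1
        have v2 := h'.var_le hT hH1 (gp_nonneg hT M j) hmono hjT (by positivity) hw2
        rw [← hd.var _ _ (gp_nonneg hT M j) hmono hjT] at v1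
        rw [← hd'.var _ _ (gp_nonneg hT M j) hmono hjT] at v2
        have hsum : C_D * (r₀ / (16 * C_D)) + C_D * (3 * (r₀ / (16 * C_D))) = r₀ / 4 := by
          field_simp; ring
        have h1 := hd.step hd' hA (gp_nonneg hT M j) hmono hjT
          (fun r hr => hE r ⟨(gp_nonneg hT M j).trans hr.1, hr.2.trans hjT⟩)
          (by linarith) r ⟨hrj, hr.2⟩
        have h2 := ih' (gp T M j) ⟨gp_nonneg hT M j, le_rfl⟩
        linarith
  intro t ht
  have h1 := claim M le_rfl t (by rwa [gp_self T hM])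
  have h2 : c ≤ κ * (1 + r₀) := by nlinarith
  have h3 : κ * (2 ^ M * (1 + r₀)) ≤ ε ^ 2 := by
    rwa [le_div_iff₀ (by positivity)] at hκ3
  have h4 : ‖φ t - φ' t‖ ^ 2 ≤ ε ^ 2 := by
    have : (2 ^ M : ℝ) * c ≤ 2 ^ M * (κ * (1 + r₀)) := by gcongr
    nlinarith
  exact (sq_le_sq₀ (norm_nonneg _) hε.le).1 h4

/-- Euler sums on the uniform grid. -/
def euler (x : ℝ → EuclideanSpace ℝ (Fin n)) (T : ℝ) (N : ℕ)
    (Φ : ℝ → EuclideanSpace ℝ (Fin d)) (t : ℝ) : EuclideanSpace ℝ (Fin d × Fin n) :=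
  ∑ k ∈ Finset.range N, tensorB d n (Φ (gp T N k))
    (x (min t (gp T N (k+1))) - x (min t (gp T N k)))

theorem min_gp_mem {T : ℝ} (hT : 0 < T) (N k : ℕ) {t : ℝ} (ht : t ∈ Icc 0 T) :
    min t (gp T N k) ∈ Icc 0 T :=
  ⟨le_min ht.1 (gp_nonneg hT N k), (min_le_left _ _).trans ht.2⟩

theorem euler_cont {x : ℝ → EuclideanSpace ℝ (Fin n)} {T : ℝ} (hT : 0 < T)
    (hx : ContinuousOn x (Icc 0 T)) (N : ℕ) (Φ : ℝ → EuclideanSpace ℝ (Fin d)) :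
    ContinuousOn (euler x T N Φ) (Icc 0 T) := by
  unfold euler
  refine continuousOn_finsetSum _ (fun k _ => ?_)
  have h1 : ∀ c : ℝ, 0 ≤ c → ContinuousOn (fun t => x (min t c)) (Icc 0 T) := by
    intro c hc
    refine hx.comp (by fun_prop) (fun t ht => ⟨le_min ht.1 hc, (min_le_left _ _).trans ht.2⟩)
  exact (tensorB d n (Φ (gp T N k))).continuous.comp_continuousOn
    ((h1 _ (gp_nonneg hT N _)).sub (h1 _ (gp_nonneg hT N _)))

theorem euler_zero {x : ℝ → EuclideanSpace ℝ (Fin n)} {T : ℝ} (hT : 0 < T)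
    (N : ℕ) (Φ : ℝ → EuclideanSpace ℝ (Fin d)) : euler x T N Φ 0 = 0 := by
  unfold euler
  refine Finset.sum_eq_zero (fun k _ => ?_)
  rw [min_eq_left (gp_nonneg hT N _), min_eq_left (gp_nonneg hT N _)]
  simp

theorem euler_congr {x : ℝ → EuclideanSpace ℝ (Fin n)} {T : ℝ} (hT : 0 < T)
    (N : ℕ) {Φ Φ' : ℝ → EuclideanSpace ℝ (Fin d)} {k : ℕ}
    (h : ∀ j ≤ k, Φ (gp T N j) = Φ' (gp T N j)) {t : ℝ} (ht : t ≤ gp T N (k+1)) :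
    euler x T N Φ t = euler x T N Φ' t := by
  unfold euler
  refine Finset.sum_congr rfl (fun j _ => ?_)
  rcases le_or_gt j k with hj | hj
  · rw [h j hj]
  · have h1 : t ≤ gp T N j := ht.trans (gp_mono hT N hj)
    have h2 : t ≤ gp T N (j+1) := h1.trans (gp_mono hT N (Nat.le_succ j))
    rw [min_eq_left h1, min_eq_left h2]; simp

theorem tensor_min {x : ℝ → EuclideanSpace ℝ (Fin n)} {Φ : ℝ → EuclideanSpace ℝ (Fin d)}
    {t a b : ℝ} (hab : a ≤ b) :
    tensorB d n (Φ a) (x (min t b) - x (min t a)) =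
      tensorB d n (Φ (min t a)) (x (min t b) - x (min t a)) := by
  rcases le_total a t with h | h
  · rw [min_eq_right h]
  · rw [min_eq_left h, min_eq_left (h.trans hab)]; simp

theorem euler_eq {x : ℝ → EuclideanSpace ℝ (Fin n)} {T : ℝ} (hT : 0 < T)
    (N : ℕ) (Φ : ℝ → EuclideanSpace ℝ (Fin d)) (t : ℝ) :
    euler x T N Φ t = ∑ k ∈ Finset.range N, tensorB d n (Φ (min t (gp T N k)))
      (x (min t (gp T N (k+1))) - x (min t (gp T N k))) :=
  Finset.sum_congr rfl (fun k _ => tensor_min (gp_mono hT N (Nat.le_succ k)))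

theorem euler_incr {x : ℝ → EuclideanSpace ℝ (Fin n)} {T : ℝ} (hT : 0 < T)
    (j m : ℕ) (Φ : ℝ → EuclideanSpace ℝ (Fin d)) {u : ℝ} (hu : gp T (j+m) j ≤ u) :
    euler x T (j+m) Φ u - euler x T (j+m) Φ (gp T (j+m) j) =
      ∑ k ∈ Finset.range m, tensorB d n (Φ (min u (gp T (j+m) (j+k))))
      (x (min u (gp T (j+m) (j+(k+1)))) - x (min u (gp T (j+m) (j+k)))) := by
  have hm := gp_mono hT (j+m)
  unfold euler
  rw [Finset.sum_range_add, Finset.sum_range_add]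
  have h1 : ∑ k ∈ Finset.range m, tensorB d n (Φ (gp T (j+m) (j+k)))
      (x (min (gp T (j+m) j) (gp T (j+m) (j+k+1))) - x (min (gp T (j+m) j) (gp T (j+m) (j+k)))) = 0 := by
    refine Finset.sum_eq_zero (fun k _ => ?_)
    rw [min_eq_left (hm (by omega)), min_eq_left (hm (by omega))]; simp
  have h2 : ∑ k ∈ Finset.range j, tensorB d n (Φ (gp T (j+m) k))
      (x (min u (gp T (j+m) (k+1))) - x (min u (gp T (j+m) k))) =
      ∑ k ∈ Finset.range j, tensorB d n (Φ (gp T (j+m) k))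
      (x (min (gp T (j+m) j) (gp T (j+m) (k+1))) - x (min (gp T (j+m) j) (gp T (j+m) k))) := by
    refine Finset.sum_congr rfl (fun k hk => ?_)
    have hk' := Finset.mem_range.1 hk
    have a1 : gp T (j+m) (k+1) ≤ gp T (j+m) j := hm (by omega)
    have a2 : gp T (j+m) k ≤ gp T (j+m) j := hm (by omega)
    rw [min_eq_right a1, min_eq_right a2, min_eq_right (a1.trans hu), min_eq_right (a2.trans hu)]
  rw [h1, h2, add_zero, add_sub_cancel_left]
  refine Finset.sum_congr rfl (fun k _ => ?_)
  exact tensor_min (hm (by omega))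

theorem SkorohodSol.restrict {D : Set (EuclideanSpace ℝ (Fin d))} {T b : ℝ} (hb : b ≤ T)
    {w w' ξ φ : ℝ → EuclideanSpace ℝ (Fin d)} (h : SkorohodSol D 0 T w ξ φ)
    (hw : ∀ t ∈ Icc 0 b, w t = w' t) : SkorohodSol D 0 b w' ξ φ := by
  have hsub : Icc 0 b ⊆ Icc 0 T := Icc_subset_Icc le_rfl hb
  obtain ⟨nv, μ, h1, h2, h3, h4⟩ := h.localTime
  exact ⟨h.xi_cont.mono hsub, fun t ht => h.xi_mem t (hsub ht), h.phi_cont.mono hsub,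
    h.phi_bv.mono hsub, h.phi_start, fun t ht => by rw [← hw t ht]; exact h.eqn t (hsub ht),
    nv, μ, h1, fun s hs => h2 s (hsub hs), fun u v hu huv hv => h3 u v hu huv (hv.trans hb),
    fun t ht => h4 t (hsub ht)⟩

/-- Existence for the Euler scheme. -/
theorem euler_exists {D : Set (EuclideanSpace ℝ (Fin d))} {T C_D : ℝ} (hT : 0 < T)
    (hH1 : CondH1 D T C_D)
    {η : ℝ → EuclideanSpace ℝ (Fin d)} (hη : ContinuousOn η (Set.Icc 0 T)) (hη0 : η 0 = 0)
    {x : ℝ → EuclideanSpace ℝ (Fin n)} (hx : ContinuousOn x (Set.Icc 0 T))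
    (F : EuclideanSpace ℝ (Fin d × Fin n) →L[ℝ] EuclideanSpace ℝ (Fin d))
    {y₀ : EuclideanSpace ℝ (Fin d)} (hy₀ : y₀ ∈ closure D) (N : ℕ) (hN : 0 < N) :
    ∃ ξ φ, SkorohodSol D 0 T (fun t => y₀ + η t + F (euler x T N φ t)) ξ φ := by
  have hex : ∀ θ : ℝ → EuclideanSpace ℝ (Fin d),
      ∃ ξ φ, SkorohodSol D 0 T (fun t => y₀ + η t + F (euler x T N θ t)) ξ φ := by
    intro θ
    refine (hH1.2.2 0 T le_rfl hT.le le_rfl _ ?_ ?_).1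
    · exact (continuousOn_const.add hη).add (F.continuous.comp_continuousOn (euler_cont hT hx N θ))
    · simp only [hη0, euler_zero hT, map_zero, add_zero]; exact hy₀
  have claim : ∀ k : ℕ, k ≤ N → ∃ θ ξ φ,
      SkorohodSol D 0 T (fun t => y₀ + η t + F (euler x T N θ t)) ξ φ ∧
      ∀ j ≤ k, θ (gp T N j) = φ (gp T N j) := by
    intro k
    induction k with
    | zero =>
      intro _
      obtain ⟨ξ, φ, h⟩ := hex (fun _ => 0)
      refine ⟨_, ξ, φ, h, fun j hj => ?_⟩
      rw [Nat.le_zero.1 hj, gp_zero, h.phi_start]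
    | succ k ih =>
      intro hk
      obtain ⟨θ, ξ, φ, h, hθ⟩ := ih (Nat.le_of_succ_le hk)
      obtain ⟨ξ', φ', h'⟩ := hex φ
      refine ⟨φ, ξ', φ', h', ?_⟩
      have hb := gp_le hT hN hk
      have r1 := h'.restrict hb (w' := fun t => y₀ + η t + F (euler x T N φ t)) (fun _ _ => rfl)
      have r2 := h.restrict hb (w' := fun t => y₀ + η t + F (euler x T N φ t)) (fun t ht => by
        simp only [euler_congr hT N hθ ht.2])
      have hu := (hH1.2.2 0 _ le_rfl (gp_nonneg hT N (k+1)) hb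
        (fun t => y₀ + η t + F (euler x T N φ t))
        (h'.w_cont.mono (Icc_subset_Icc le_rfl hb))
        (by simp only [hη0, euler_zero hT, map_zero, add_zero]; exact hy₀)).2.1 _ _ _ _ r2 r1
      intro j hj
      exact (hu _ ⟨gp_nonneg hT N j, gp_mono hT N hj⟩).2
  obtain ⟨θ, ξ, φ, h, hθ⟩ := claim N le_rfl
  refine ⟨ξ, φ, h.restrict le_rfl (fun t ht => ?_)⟩
  have : t ≤ gp T N (N+1) :=
    ht.2.trans ((gp_self T hN).ge.trans (gp_mono hT N (Nat.le_succ N)))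
  simp only [euler_congr hT N hθ this]

/-- A priori bound. -/
theorem euler_apriori {D : Set (EuclideanSpace ℝ (Fin d))} {T C_D : ℝ} (hT : 0 < T)
    (hH1 : CondH1 D T C_D)
    {η : ℝ → EuclideanSpace ℝ (Fin d)} (hη : ContinuousOn η (Set.Icc 0 T))
    {x : ℝ → EuclideanSpace ℝ (Fin n)} (hx : ContinuousOn x (Set.Icc 0 T))
    (F : EuclideanSpace ℝ (Fin d × Fin n) →L[ℝ] EuclideanSpace ℝ (Fin d))
    (y₀ : EuclideanSpace ℝ (Fin d)) :
    ∃ (M : ℕ) (V : ℝ), 0 < M ∧ ∀ m : ℕ, 0 < m → ∀ ξ φ,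
      SkorohodSol D 0 T (fun t => y₀ + η t + F (euler x T (M * m) φ t)) ξ φ →
      totalVar φ 0 T ≤ V := by
  have hC := hH1.2.1
  set ω := 1 / (8 * C_D * (‖F‖ + 1)) with hωdef
  have hω : 0 < ω := by positivity
  obtain ⟨δ, hδ, hmod⟩ := unif_mod hx hω
  obtain ⟨M, hM, hMδ⟩ := exists_grid T hδ
  obtain ⟨K, hK, hηK⟩ := bdd_of_cont hη
  refine ⟨M, (2 ^ M - 1) * (4 * C_D * K), hM, fun m hm ξ φ h => ?_⟩
  obtain ⟨g, ν, hd⟩ := h.data hT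
  have hFω : C_D * (‖F‖ * ω) ≤ 1 / 8 := by
    rw [hωdef]
    have : C_D * (‖F‖ * (1 / (8 * C_D * (‖F‖ + 1)))) = (‖F‖ / (‖F‖ + 1)) / 8 := by
      field_simp
    rw [this]
    have : ‖F‖ / (‖F‖ + 1) ≤ 1 := by
      rw [div_le_one (by positivity)]; linarith
    linarith
  have hdist : ∀ j, ∀ u ∈ Icc (gp T M j) (gp T M (j+1)), ∀ v ∈ Icc (gp T M j) (gp T M (j+1)),
      |u - v| ≤ δ := by
    intro j u hu v hv
    rw [gp_succ] at hu hv
    rw [abs_le]; constructor <;> linarith [hu.1, hu.2, hv.1, hv.2]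
  have claim : ∀ j : ℕ, j ≤ M → ν.real (Ioc 0 (gp T M j)) ≤ (2 ^ j - 1) * (4 * C_D * K) := by
    intro j
    induction j with
    | zero => intro _; simp [gp_zero]
    | succ j ih =>
      intro hj
      have ih' := ih (Nat.le_of_succ_le hj)
      have hjT := gp_le hT hM hj
      have hj0 := gp_nonneg hT M j
      have hmono := gp_mono hT M (Nat.le_succ j)
      set s := gp T M j with hs
      set t := gp T M (j+1) with ht
      set V := ν.real (Ioc s t) with hV
      have hV0 : 0 ≤ V := measureReal_nonneg
      have hinc : ∀ u ∈ Icc s t, ‖euler x T (M * m) φ u - euler x T (M * m) φ s‖ ≤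
          ω * (‖φ s‖ + 2 * V) := by
        intro u hu
        obtain ⟨q, hq⟩ : ∃ q, M * m = j * m + q :=
          ⟨M * m - j * m, (Nat.add_sub_cancel' (Nat.mul_le_mul_right m (Nat.le_of_succ_le hj))).symm⟩
        have hs' : s = gp T (j * m + q) (j * m) := by rw [← hq, gp_mul T M m j hm]
        have hN : 0 < j * m + q := by rw [← hq]; positivity
        have huT : u ≤ T := hu.2.trans hjT
        rw [hq]
        have hus : gp T (j * m + q) (j * m) ≤ u := by rw [← hs']; exact hu.1
        have e := euler_incr (x := x) hT (j * m) q φ hus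
        rw [← hs'] at e
        rw [e]
        have b := hd.rs_norm_le hx (ω := ω) (fun k => min u (gp T (j * m + q) (j * m + k)))
          (fun a b hab => min_le_min_left _ (gp_mono hT _ (by omega)))
          (le_min (hj0.trans hu.1) (gp_nonneg hT _ _)) q ((min_le_left _ _).trans huT)
        simp only [add_zero, gp_self T hN, min_eq_left huT] at b
        rw [← hs', min_eq_right hu.1] at b
        refine (b ?_).trans ?_
        · intro a ha c hc
          exact hmod a ⟨hj0.trans ha.1, ha.2.trans huT⟩ c ⟨hj0.trans hc.1, hc.2.trans huT⟩
            (hdist j a ⟨ha.1, ha.2.trans hu.2⟩ c ⟨hc.1, hc.2.trans hu.2⟩)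
        · have := hd.var_mono (le_refl s) hu.2
          gcongr
      have hvar := h.var_le hT hH1 hj0 hmono hjT
        (K := 2 * K + ‖F‖ * (2 * (ω * (‖φ s‖ + 2 * V)))) (by positivity) (by
          intro u hu v hv
          have e1 := hηK u ⟨hj0.trans hu.1, hu.2.trans hjT⟩
          have e2 := hηK v ⟨hj0.trans hv.1, hv.2.trans hjT⟩
          have e3 := hinc u hu
          have e4 := hinc v hv
          have e5 : (y₀ + η u + F (euler x T (M * m) φ u)) - (y₀ + η v + F (euler x T (M * m) φ v))
            = (η u - η v) + F ((euler x T (M * m) φ u - euler x T (M * m) φ s) -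
                (euler x T (M * m) φ v - euler x T (M * m) φ s)) := by
            simp only [map_sub]; abel
          rw [e5]
          refine (norm_add_le _ _).trans (add_le_add ((norm_sub_le _ _).trans (by linarith)) ?_)
          refine (F.le_opNorm _).trans (mul_le_mul_of_nonneg_left ?_ (norm_nonneg _))
          exact (norm_sub_le _ _).trans (by linarith))
      rw [← hd.var s t hj0 hmono hjT, ← hV] at hvar
      have hφs := hd.norm_le hj0 (hmono.trans hjT)
      have h0 : 0 ≤ ‖φ s‖ + 2 * V := by positivity
      have h1 : C_D * (‖F‖ * ω) * (2 * (‖φ s‖ + 2 * V)) ≤ 1 / 8 * (2 * (‖φ s‖ + 2 * V)) :=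
        mul_le_mul_of_nonneg_right hFω (by positivity)
      have h2 : V ≤ 4 * C_D * K + ‖φ s‖ := by nlinarith [norm_nonneg (φ s)]
      rw [hd.var_add hj0 hmono, pow_succ]
      nlinarith
  have := claim M le_rfl
  rwa [gp_self T hM, hd.var 0 T le_rfl hT.le le_rfl] at this

/-- Uniform convergence of Riemann sums. -/
theorem rs_unif {T : ℝ} {x : ℝ → EuclideanSpace ℝ (Fin n)}
    (hx : ContinuousOn x (Icc 0 T)) {V ε : ℝ} (hV : 0 ≤ V) (hε : 0 < ε) :
    ∃ δ > 0, ∀ (D : Set (EuclideanSpace ℝ (Fin d))) (ξ φ g : ℝ → EuclideanSpace ℝ (Fin d))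
      (ν : Measure ℝ), SkData D T ξ φ g ν → ν.real (Ioc 0 T) ≤ V →
      ∀ (N : ℕ) (t : ℕ → ℝ), Monotone t → t 0 = 0 → t N ≤ T → (∀ k < N, t (k+1) - t k ≤ δ) →
      ‖(∑ k ∈ Finset.range N, tensorB d n (φ (t k)) (x (t (k+1)) - x (t k)))
      - (tensorB d n (φ (t N)) (x (t N)) - ∫ r in Ioc 0 (t N), tensorB d n (g r) (x r) ∂ν)‖ ≤ ε := by
  obtain ⟨δ, hδ, hmod⟩ := unif_mod hx (ε := ε / (V + 1)) (by positivity)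
  refine ⟨δ, hδ, fun D ξ φ g ν h hν N t ht h0 hN hmesh => ?_⟩
  have h1 := h.rs_bound hx (ω := ε / (V + 1)) t ht h0.ge N hN (by
    intro k hk r hr
    have a0 : 0 ≤ t k := h0 ▸ ht (Nat.zero_le k)
    have a1 : t (k+1) ≤ T := (ht hk).trans hN
    have a2 := hmesh k hk
    refine hmod r ⟨a0.trans hr.1, hr.2.trans a1⟩ _ ⟨a0.trans (ht (Nat.le_succ k)), a1⟩ ?_
    rw [abs_le]; constructor <;> linarith [hr.1, hr.2])
  rw [h0, h.zero] at h1
  simp only [map_zero, zero_apply, sub_zero] at h1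
  refine h1.trans ?_
  have h2 : ν.real (Ioc 0 (t N)) ≤ V := (h.var_mono le_rfl hN).trans hν
  calc ε / (V + 1) * ν.real (Ioc 0 (t N)) ≤ ε / (V + 1) * (V + 1) :=
        mul_le_mul_of_nonneg_left (by linarith) (by positivity)
    _ = ε := by field_simp

theorem ultra_lim {E : Type*} [NormedAddCommGroup E] [ProperSpace E] {a : ℕ → E} {V : ℝ}
    (h : ∀ k, ‖a k‖ ≤ V) : ∃ l, Filter.Tendsto a (Filter.hyperfilter ℕ : Filter ℕ) (nhds l) := by
  obtain ⟨l, -, hl⟩ := (isCompact_closedBall (0:E) V).ultrafilter_le_nhds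
    ((Filter.hyperfilter ℕ).map a) (by
      rw [Filter.le_principal_iff]
      have hev : ∀ᶠ k in (Filter.hyperfilter ℕ : Filter ℕ), a k ∈ Metric.closedBall (0:E) V :=
        Filter.Eventually.of_forall (fun k => by simpa using h k)
      exact hev)
  exact ⟨l, hl⟩

end Aux

/-- Lemma 4.2 (2): existence of a solution to the implicit Skorohod
equation driven by a continuous path of finite `p`-variation, under condition (H1). -/
theorem implicit_skorohod_existence {d n : ℕ}
    (D : Set (EuclideanSpace ℝ (Fin d))) (T C_D p : ℝ) (hT : 0 < T) (hp : 1 ≤ p)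
    (hH1 : CondH1 D T C_D)
    (η : ℝ → EuclideanSpace ℝ (Fin d)) (hη : ContinuousOn η (Set.Icc 0 T)) (hη0 : η 0 = 0)
    (x : ℝ → EuclideanSpace ℝ (Fin n))
    (hxc : ContinuousOn x (Set.Icc 0 T)) (hxpv : FinitePVar x p 0 T) (hx0 : x 0 = 0)
    (F : EuclideanSpace ℝ (Fin d × Fin n) →L[ℝ] EuclideanSpace ℝ (Fin d))
    (y₀ : EuclideanSpace ℝ (Fin d)) (hy₀ : y₀ ∈ closure D) :
    ∃ (y Φ : ℝ → EuclideanSpace ℝ (Fin d)) (z : ℝ → EuclideanSpace ℝ (Fin d × Fin n)),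
      (∀ t ∈ Set.Icc (0 : ℝ) T, IsRSTensorIntegral Φ x 0 t (z t)) ∧
      SkorohodSol D 0 T (fun t => y₀ + η t + F (z t)) y Φ := by
  obtain ⟨M, V, hM, hap⟩ := euler_apriori hT hH1 hη hxc F y₀
  have hex := fun k : ℕ => euler_exists hT hH1 hη hη0 hxc F hy₀ (M * (k+1)) (by positivity)
  choose ξ φ hsol using hex
  choose g ν hd using fun k => (hsol k).data hT
  have hνV : ∀ k, (ν k).real (Ioc 0 T) ≤ V := fun k => by
    rw [(hd k).var 0 T le_rfl hT.le le_rfl]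
    exact hap (k+1) (Nat.succ_pos k) _ _ (hsol k)
  have hV : 0 ≤ V := measureReal_nonneg.trans (hνV 0)
  obtain ⟨X, hX, hxX⟩ := bdd_of_cont hxc
  have hφV : ∀ k, ∀ t ∈ Icc (0:ℝ) T, ‖φ k t‖ ≤ V := fun k t ht =>
    ((hd k).norm_le ht.1 ht.2).trans (((hd k).var_mono le_rfl ht.2).trans (hνV k))
  set U : Filter ℕ := (Filter.hyperfilter ℕ : Filter ℕ) with hU
  -- integrated-by-parts integrals
  set Z : ℕ → ℝ → EuclideanSpace ℝ (Fin d × Fin n) := fun k t =>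
    tensorB d n (φ k t) (x t) - ∫ r in Ioc 0 t, tensorB d n (g k r) (x r) ∂(ν k) with hZ
  have hZV : ∀ k, ∀ t ∈ Icc (0:ℝ) T, ‖Z k t‖ ≤ V * X + X * V := by
    intro k t ht
    have h1 := (hd k).norm_int_tensor_le hxc le_rfl ht.1 ht.2 0 (ω := X)
      (fun r hr => by rw [sub_zero]; exact hxX r ⟨hr.1, hr.2.trans ht.2⟩)
    rw [map_zero, sub_zero] at h1
    refine (norm_sub_le _ _).trans (add_le_add ?_ (h1.trans ?_))
    · rw [norm_tensorB]
      exact mul_le_mul (hφV k t ht) (hxX t ht) (norm_nonneg _) hV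
    · exact mul_le_mul_of_nonneg_left (((hd k).var_mono le_rfl ht.2).trans (hνV k)) hX.le
  have hψ : ∀ t, ∃ l, t ∈ Icc (0:ℝ) T → Filter.Tendsto (fun k => φ k t) U (nhds l) := by
    intro t
    by_cases ht : t ∈ Icc (0:ℝ) T
    · obtain ⟨l, hl⟩ := ultra_lim (fun k => hφV k t ht)
      exact ⟨l, fun _ => hl⟩
    · exact ⟨0, fun h => absurd h ht⟩
  choose ψ hψ using hψ
  have hz : ∀ t, ∃ l, t ∈ Icc (0:ℝ) T → Filter.Tendsto (fun k => Z k t) U (nhds l) := by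
    intro t
    by_cases ht : t ∈ Icc (0:ℝ) T
    · obtain ⟨l, hl⟩ := ultra_lim (fun k => hZV k t ht)
      exact ⟨l, fun _ => hl⟩
    · exact ⟨0, fun h => absurd h ht⟩
  choose z hz using hz
  -- Riemann sums of the limit
  have hRS : ∀ ε > 0, ∃ δ > 0, ∀ (N : ℕ) (t : ℕ → ℝ), Monotone t → t 0 = 0 → t N ≤ T →
      (∀ k < N, t (k+1) - t k ≤ δ) →
      ‖(∑ k ∈ Finset.range N, tensorB d n (ψ (t k)) (x (t (k+1)) - x (t k))) - z (t N)‖ ≤ ε ∧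
      ∀ i, ‖(∑ k ∈ Finset.range N, tensorB d n (φ i (t k)) (x (t (k+1)) - x (t k)))
        - Z i (t N)‖ ≤ ε := by
    intro ε hε
    obtain ⟨δ, hδ, H⟩ := rs_unif (d := d) hxc hV hε
    refine ⟨δ, hδ, fun N t ht h0 hN hmesh => ?_⟩
    have h1 : ∀ i, ‖(∑ k ∈ Finset.range N, tensorB d n (φ i (t k)) (x (t (k+1)) - x (t k)))
        - Z i (t N)‖ ≤ ε := fun i => H D _ _ _ _ (hd i) (hνV i) N t ht h0 hN hmesh
    refine ⟨?_, h1⟩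
    have hmem : ∀ k ≤ N, t k ∈ Icc 0 T := fun k hk =>
      ⟨h0 ▸ ht (Nat.zero_le k), (ht hk).trans hN⟩
    refine le_of_tendsto (f := fun i => ‖(∑ k ∈ Finset.range N, tensorB d n (φ i (t k))
      (x (t (k+1)) - x (t k))) - Z i (t N)‖) (x := U) ?_ (Filter.Eventually.of_forall h1)
    refine (Filter.Tendsto.sub (tendsto_finsetSum _ fun k hk => ?_) (hz _ (hmem N le_rfl))).norm
    have h2 := hψ (t k) (hmem k (Finset.mem_range.1 hk).le)
    exact ((((tensorB d n).flip (x (t (k+1)) - x (t k))).continuous.tendsto _).comp h2)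
  -- the Euler sums are Riemann sums
  have hEu : ∀ ε > 0, ∃ δ > 0, ∀ N : ℕ, 0 < N → T / N ≤ δ → ∀ t ∈ Icc (0:ℝ) T,
      ‖euler x T N ψ t - z t‖ ≤ ε ∧ ∀ i, ‖euler x T N (φ i) t - Z i t‖ ≤ ε := by
    intro ε hε
    obtain ⟨δ, hδ, H⟩ := hRS ε hε
    refine ⟨δ, hδ, fun N hN hNδ t ht => ?_⟩
    have h1 := H N (fun k => min t (gp T N k))
      (fun a b hab => min_le_min_left _ (gp_mono hT N hab))
      (by simp only [gp_zero]; exact min_eq_right ht.1)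
      ((min_le_left _ _).trans ht.2)
      (by
        intro k _
        simp only [gp_succ]
        have hTN : 0 ≤ T / N := by positivity
        rcases le_total t (gp T N k) with h | h
        · rw [min_eq_left h, min_eq_left (h.trans (by linarith))]; linarith
        · rw [min_eq_right h]
          have := min_le_right t (gp T N k + T / N)
          linarith)
    simp only [gp_self T hN, min_eq_left ht.2] at h1
    simp only [euler_eq hT]
    exact h1
  have hunif : ∀ ε > 0, ∀ᶠ i in U, ∀ t ∈ Icc (0:ℝ) T,
      ‖z t - euler x T (M * (i+1)) (φ i) t‖ ≤ ε := by
    intro ε hε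
    obtain ⟨δ, hδ, H⟩ := hEu (ε / 4) (by positivity)
    obtain ⟨L, hL, hLδ⟩ := exists_grid T hδ
    have e1 : ∀ᶠ i in U, L ≤ i := Nat.hyperfilter_le_atTop (Filter.eventually_ge_atTop L)
    have e2 : ∀ᶠ i in U, ∀ k ∈ Finset.range L,
        ‖φ i (gp T L k) - ψ (gp T L k)‖ ≤ ε / (8 * X * L) := by
      rw [Finset.eventually_all]
      intro k hk
      have hmem : gp T L k ∈ Icc 0 T :=
        ⟨gp_nonneg hT L k, gp_le hT hL (Finset.mem_range.1 hk).le⟩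
      have h2 := hψ _ hmem
      rw [tendsto_iff_norm_sub_tendsto_zero] at h2
      have hpos : 0 < ε / (8 * X * L) := by positivity
      exact (h2.eventually (gt_mem_nhds hpos)).mono (fun _ h => h.le)
    filter_upwards [e1, e2] with i hi hφi t ht
    have hNi : T / ((M * (i+1) : ℕ) : ℝ) ≤ δ := by
      refine le_trans ?_ hLδ
      have : L ≤ M * (i+1) := by nlinarith
      have : (L:ℝ) ≤ ((M * (i+1) : ℕ) : ℝ) := by exact_mod_cast this
      gcongr
    have a1 := (H (M * (i+1)) (by positivity) hNi t ht).2 i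
    have a2 := (H L hL hLδ t ht).2 i
    have a3 := (H L hL hLδ t ht).1
    have a4 : ‖euler x T L (φ i) t - euler x T L ψ t‖ ≤ ε / 4 := by
      unfold euler
      rw [← Finset.sum_sub_distrib]
      have hterm : ∀ k ∈ Finset.range L, ‖tensorB d n (φ i (gp T L k))
          (x (min t (gp T L (k+1))) - x (min t (gp T L k))) - tensorB d n (ψ (gp T L k))
          (x (min t (gp T L (k+1))) - x (min t (gp T L k)))‖ ≤ ε / (8 * X * L) * (2 * X) := by
        intro k hk
        rw [← sub_apply, ← map_sub, norm_tensorB]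
        refine mul_le_mul (hφi k hk) ?_ (norm_nonneg _) (by positivity)
        have b1 := hxX _ (min_gp_mem hT L (k+1) ht)
        have b2 := hxX _ (min_gp_mem hT L k ht)
        exact (norm_sub_le _ _).trans (by linarith)
      refine (norm_sum_le_of_le _ hterm).trans (le_of_eq ?_)
      rw [Finset.sum_const, Finset.card_range, nsmul_eq_mul]
      field_simp
      norm_num
    have e : z t - euler x T (M * (i+1)) (φ i) t =
        -(euler x T (M * (i+1)) (φ i) t - Z i t) + (euler x T L (φ i) t - Z i t)
        - (euler x T L (φ i) t - euler x T L ψ t) - (euler x T L ψ t - z t) := by abel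
    rw [e]
    have c1 := norm_sub_le (-(euler x T (M * (i+1)) (φ i) t - Z i t) +
      (euler x T L (φ i) t - Z i t) - (euler x T L (φ i) t - euler x T L ψ t))
      (euler x T L ψ t - z t)
    have c2 := norm_sub_le (-(euler x T (M * (i+1)) (φ i) t - Z i t) +
      (euler x T L (φ i) t - Z i t)) (euler x T L (φ i) t - euler x T L ψ t)
    have c3 := norm_add_le (-(euler x T (M * (i+1)) (φ i) t - Z i t)) (euler x T L (φ i) t - Z i t)
    rw [norm_neg] at c3
    linarith
  have hzc : ContinuousOn z (Icc 0 T) := by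
    have hTU : TendstoUniformlyOn (fun i => euler x T (M * (i+1)) (φ i)) z U (Icc 0 T) := by
      rw [Metric.tendstoUniformlyOn_iff]
      intro ε hε
      filter_upwards [hunif (ε / 2) (by positivity)] with i hi t ht
      rw [dist_eq_norm]
      linarith [hi t ht]
    exact hTU.continuousOn (Filter.Eventually.of_forall
      (fun i => euler_cont hT hxc _ _)).frequently
  have hz0 : z 0 = 0 := by
    have h0 : (0:ℝ) ∈ Icc 0 T := ⟨le_rfl, hT.le⟩
    refine tendsto_nhds_unique (hz 0 h0) ?_
    have : (fun k => Z k 0) = fun _ => 0 := by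
      funext k
      simp [hZ, (hd k).zero]
    rw [this]
    exact tendsto_const_nhds
  obtain ⟨y, Φ, hyΦ⟩ := (hH1.2.2 0 T le_rfl hT.le le_rfl (fun t => y₀ + η t + F (z t))
    ((continuousOn_const.add hη).add (F.continuous.comp_continuousOn hzc))
    (by simp only [hη0, hz0, map_zero, add_zero]; exact hy₀)).1
  have hlim : ∀ t ∈ Icc (0:ℝ) T, ψ t = Φ t := by
    intro t ht
    refine tendsto_nhds_unique (hψ t ht) ?_
    rw [Metric.tendsto_nhds]
    intro ε hε
    obtain ⟨κ, hκ, H⟩ := skorohod_cont hT hH1 hyΦ (ε := ε / 2) (by positivity)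
    filter_upwards [hunif (κ / (‖F‖ + 1)) (by positivity)] with i hi
    have h1 := H _ _ _ (hsol i) (by
      intro s hs
      have e : (y₀ + η s + F (z s)) - (y₀ + η s + F (euler x T (M * (i+1)) (φ i) s)) =
          F (z s - euler x T (M * (i+1)) (φ i) s) := by
        rw [map_sub]; abel
      rw [e]
      refine (F.le_opNorm _).trans ?_
      calc ‖F‖ * ‖z s - euler x T (M * (i+1)) (φ i) s‖ ≤ (‖F‖ + 1) * (κ / (‖F‖ + 1)) :=
            mul_le_mul (by linarith) (hi s hs) (norm_nonneg _) (by positivity)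
        _ = κ := by field_simp) t ht
    rw [dist_eq_norm, norm_sub_rev]
    linarith
  refine ⟨y, Φ, z, ?_, hyΦ⟩
  intro b hb ε hε
  obtain ⟨δ, hδ, H⟩ := hRS ε hε
  refine ⟨δ, hδ, fun N t ht h0 hN hmesh => ?_⟩
  have hidx : ∀ k, min k N < N + 1 := fun k => Nat.lt_succ_of_le (min_le_right k N)
  have h1 := (H N (fun k => t ⟨min k N, hidx k⟩)
    (fun a c hac => ht (by simp only [Fin.mk_le_mk]; exact min_le_min_right N hac))
    (by
      have : (⟨min 0 N, hidx 0⟩ : Fin (N+1)) = 0 := by ext; simp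
      simp only [this, h0])
    (by
      have : (⟨min N N, hidx N⟩ : Fin (N+1)) = Fin.last N := by ext; simp
      simp only [this, hN]; exact hb.2)
    (by
      intro k hk
      have a1 : (⟨min (k+1) N, hidx (k+1)⟩ : Fin (N+1)) = (⟨k, hk⟩ : Fin N).succ := by
        ext; simp; omega
      have a2 : (⟨min k N, hidx k⟩ : Fin (N+1)) = (⟨k, hk⟩ : Fin N).castSucc := by
        ext; simp; omega
      simp only [a1, a2]
      exact hmesh _)).1
  have hlast : (⟨min N N, hidx N⟩ : Fin (N+1)) = Fin.last N := by ext; simp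
  simp only [hlast, hN] at h1
  rw [Finset.sum_range] at h1
  refine le_trans (le_of_eq ?_) h1
  congr 2
  refine Finset.sum_congr rfl (fun k _ => ?_)
  have a1 : (⟨min (k+1 : ℕ) N, hidx (k+1)⟩ : Fin (N+1)) = k.succ := by
    ext; simp
  have a2 : (⟨min (k : ℕ) N, hidx k⟩ : Fin (N+1)) = k.castSucc := by
    ext; simp
  rw [a1, a2, tensorB_apply, hlim]
  refine ⟨h0 ▸ ht (Fin.zero_le _), ?_⟩
  exact ((ht (Fin.le_last k.castSucc)).trans_eq hN).trans hb.2


end
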